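/- arXiv:1906.09164 — 3 statements merged into one kernel-verified Lean document; each statement's English description precedes it below -/
import Mathlib

section
/- Let V and W be reflexive Banach spaces over ℝ, let B ∈ Lis(W, W') be coercive, i.e. β := inf_{0≠w∈W} (Bw)(w)/‖w‖²_W > 0, and let D ∈ Lis(V, W') with adjoint D' ∈ Lis(W, V'). Then G := D⁻¹ ∘ B ∘ (D')⁻¹ ∈ Lis(V', V) is coercive, i.e. inf_{0≠f∈V'} f(Gf)/‖f‖²_{V'} > 0, and moreover ‖Re(G)⁻¹‖_{L(V,V')} ≤ ‖D‖²_{L(V,W')} · ‖Re(B)⁻¹‖_{L(W',W)}, where Re(B) := ½(B + B') and Re(G) := ½(G + G') (adjoints taken with the canonical reflexivity identifications). -/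
/-- A coercive operator from a reflexive Banach space to its dual is bijective
(Lax-Milgram lemma). -/
theorem exists_equiv_of_coercive {W : Type*}
    [NormedAddCommGroup W] [NormedSpace ℝ W] [CompleteSpace W]
    (hW : Function.Surjective ⇑(NormedSpace.inclusionInDoubleDual ℝ W))
    (A : W →L[ℝ] (W →L[ℝ] ℝ)) {β : ℝ} (hβ : 0 < β) (hA : ∀ w : W, β * ‖w‖ ^ 2 ≤ A w w) :
    ∃ E : W ≃L[ℝ] (W →L[ℝ] ℝ), ∀ w, E w = A w := by
  have hbound : ∀ w, ‖w‖ ≤ (⟨β⁻¹, by positivity⟩ : NNReal) * ‖A w‖ := by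
    intro w
    change ‖w‖ ≤ β⁻¹ * ‖A w‖
    rw [inv_mul_eq_div, le_div_iff₀' hβ]
    rcases (norm_nonneg w).eq_or_lt with h | h
    · simp [← h]
    · have h1 : A w w ≤ ‖A w‖ * ‖w‖ := (le_abs_self _).trans ((A w).le_opNorm w)
      have h2 : (β * ‖w‖) * ‖w‖ ≤ ‖A w‖ * ‖w‖ := by linarith [hA w, sq ‖w‖]
      exact le_of_mul_le_mul_right h2 h
  have hanti := A.antilipschitz_of_bound hbound
  have hclosed : IsClosed (A.range : Set (W →L[ℝ] ℝ)) := by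
    rw [LinearMap.coe_range]
    exact hanti.isClosed_range A.uniformContinuous
  refine ⟨ContinuousLinearEquiv.ofBijective A (LinearMap.ker_eq_bot.mpr hanti.injective) ?_,
    fun w => rfl⟩
  by_contra hne
  obtain ⟨x, -, hx⟩ := SetLike.exists_of_lt (lt_top_iff_ne_top.mpr hne)
  obtain ⟨φ, u, hu, hux⟩ :=
    geometric_hahn_banach_closed_point (A.range).convex hclosed (x := x) hx
  obtain ⟨w, rfl⟩ := hW φ
  have hu0 : 0 < u := by simpa using hu 0 (Submodule.zero_mem _)
  have hAw : A w w = 0 := by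
    by_contra h
    have hlt := hu (A ((u / A w w) • w)) ⟨_, rfl⟩
    simp [NormedSpace.dual_def, h] at hlt
  have hw : w = 0 := by
    have h := hA w
    rw [hAw] at h
    have h' : ‖w‖ ^ 2 ≤ 0 := by
      by_contra! hpos
      exact absurd (mul_pos hβ hpos) (not_lt.mpr h)
    simpa using le_antisymm h' (sq_nonneg _)
  subst hw
  simp at hux
  linarith

/-- Operator preconditioning (Prop. 3.1, second part): if additionally `B` is coercive, then
`G := D⁻¹ ∘ B ∘ (D')⁻¹` is coercive, and `‖Re(G)⁻¹‖ ≤ ‖D‖² ‖Re(B)⁻¹‖`,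
where `Re(B) = ½(B + B')` and `Re(G) = ½(G + G')` (with the canonical reflexivity
identifications, so that `Re(G)` is characterized by `f(Re(G) g) = ½(f(G g) + g(G f))`). -/
theorem stmt1 {V W : Type*}
    [NormedAddCommGroup V] [NormedSpace ℝ V] [CompleteSpace V]
    [NormedAddCommGroup W] [NormedSpace ℝ W] [CompleteSpace W]
    (hV : Function.Surjective ⇑(NormedSpace.inclusionInDoubleDual ℝ V))
    (hW : Function.Surjective ⇑(NormedSpace.inclusionInDoubleDual ℝ W))
    (B : W ≃L[ℝ] (W →L[ℝ] ℝ))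
    (hB : ∃ β > 0, ∀ w : W, β * ‖w‖ ^ 2 ≤ B w w)
    (D : V ≃L[ℝ] (W →L[ℝ] ℝ)) (D' : W ≃L[ℝ] (V →L[ℝ] ℝ))
    (hD' : ∀ (v : V) (w : W), D' w v = D v w) :
    ∀ G : (V →L[ℝ] ℝ) →L[ℝ] V,
      G = D.symm.toContinuousLinearMap.comp
            (B.toContinuousLinearMap.comp D'.symm.toContinuousLinearMap) →
      (∃ c > 0, ∀ f : V →L[ℝ] ℝ, c * ‖f‖ ^ 2 ≤ f (G f)) ∧
      ∀ ReG : (V →L[ℝ] ℝ) →L[ℝ] V,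
        (∀ f g : V →L[ℝ] ℝ, f (ReG g) = (f (G g) + g (G f)) / 2) →
        ∃ ReGinv : V →L[ℝ] (V →L[ℝ] ℝ),
          ReG.comp ReGinv = ContinuousLinearMap.id ℝ V ∧
          ReGinv.comp ReG = ContinuousLinearMap.id ℝ (V →L[ℝ] ℝ) ∧
          ∀ ReBinv : (W →L[ℝ] ℝ) →L[ℝ] W,
            ((1 / 2 : ℝ) • (B.toContinuousLinearMap + B.toContinuousLinearMap.flip)).comp ReBinv
                = ContinuousLinearMap.id ℝ (W →L[ℝ] ℝ) →
            ReBinv.comp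
                ((1 / 2 : ℝ) • (B.toContinuousLinearMap + B.toContinuousLinearMap.flip))
                = ContinuousLinearMap.id ℝ W →
            ‖ReGinv‖ ≤ ‖D.toContinuousLinearMap‖ ^ 2 * ‖ReBinv‖ := by
  rintro G rfl
  obtain ⟨β, hβ, hB⟩ := hB
  refine ⟨⟨β / (‖D'.toContinuousLinearMap‖ ^ 2 + 1), by positivity, fun f => ?_⟩, ?_⟩
  · obtain ⟨w, rfl⟩ := D'.surjective f
    have hG : D' w (D.symm (B (D'.symm (D' w)))) = B w w := by
      rw [hD', D.apply_symm_apply, D'.symm_apply_apply]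
    change _ ≤ D' w (D.symm (B (D'.symm (D' w))))
    rw [hG]
    refine le_trans ?_ (hB w)
    have h1 : ‖D' w‖ ≤ ‖D'.toContinuousLinearMap‖ * ‖w‖ := D'.toContinuousLinearMap.le_opNorm w
    have h2 : ‖D' w‖ ^ 2 ≤ (‖D'.toContinuousLinearMap‖ ^ 2 + 1) * ‖w‖ ^ 2 := by
      have := pow_le_pow_left₀ (norm_nonneg _) h1 2
      nlinarith [sq_nonneg ‖w‖]
    rw [div_mul_eq_mul_div, div_le_iff₀ (by positivity)]
    nlinarith [mul_le_mul_of_nonneg_left h2 hβ.le]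
  · intro ReG hReG
    obtain ⟨E, hE⟩ := exists_equiv_of_coercive hW
      ((1 / 2 : ℝ) • (B.toContinuousLinearMap + B.toContinuousLinearMap.flip)) hβ (fun w => by
        have h := hB w
        simp
        linarith)
    have hReG' : ∀ w, ReG (D' w) = D.symm (E w) := by
      intro w
      refine (SeparatingDual.eq_iff_forall_dual_eq (R := ℝ)).mpr fun f => ?_
      obtain ⟨u, rfl⟩ := D'.surjective f
      rw [hReG]
      simp [hD', hE]
      ring
    refine ⟨D'.toContinuousLinearMap.comp (E.symm.toContinuousLinearMap.comp
      D.toContinuousLinearMap), ?_, ?_, ?_⟩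
    · ext v
      simp [hReG']
    · refine ContinuousLinearMap.ext fun f => ?_
      obtain ⟨w, rfl⟩ := D'.surjective f
      simp [hReG']
    · intro R _ hR
      have hRE : E.symm.toContinuousLinearMap = R := by
        refine ContinuousLinearMap.ext fun φ => ?_
        obtain ⟨w, rfl⟩ := E.surjective φ
        have h := congrArg (fun T : W →L[ℝ] W => T w) hR
        rw [hE w]
        refine Eq.trans ?_ h.symm
        rw [← hE w]
        simp
      have hD'norm : ‖D'.toContinuousLinearMap‖ ≤ ‖D.toContinuousLinearMap‖ := by
        have hnonneg : 0 ≤ ‖D.toContinuousLinearMap‖ := ContinuousLinearMap.opNorm_nonneg _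
        refine ContinuousLinearMap.opNorm_le_bound₂ _ hnonneg fun w v => ?_
        change ‖D' w v‖ ≤ _
        rw [hD']
        calc ‖D v w‖ ≤ ‖D.toContinuousLinearMap‖ * ‖v‖ * ‖w‖ :=
              D.toContinuousLinearMap.le_opNorm₂ v w
          _ = _ := by ring
      rw [hRE]
      calc _ ≤ ‖D'.toContinuousLinearMap‖ * (‖R‖ * ‖D.toContinuousLinearMap‖) :=
            (ContinuousLinearMap.opNorm_comp_le _ _).trans
              (mul_le_mul_of_nonneg_left (ContinuousLinearMap.opNorm_comp_le _ _) (norm_nonneg _))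
        _ ≤ ‖D.toContinuousLinearMap‖ * (‖R‖ * ‖D.toContinuousLinearMap‖) := by gcongr
        _ = _ := by ring
end

section
/- Let Z be a real inner product space, Y ⊆ Z a subspace, and Q : Y → Z a bounded linear map with q := ‖Q‖_{L(Y,Z)} (no projector property assumed). Let U and B be subspaces of Z with Qy ∈ U and y − Qy ∈ B for every y ∈ Y, and let b_U : U × U → ℝ and b_B : B × B → ℝ be bilinear forms with |b_U(u,ũ)| ≤ M_U‖u‖‖ũ‖, b_U(u,u) ≥ m_U‖u‖², |b_B(v,ṽ)| ≤ M_B‖v‖‖ṽ‖, b_B(v,v) ≥ m_B‖v‖² (m_U, m_B > 0). Define b(y,ỹ) := b_U(Qy, Qỹ) + b_B(y − Qy, ỹ − Qỹ) on Y. Then for all y, ỹ ∈ Y: |b(y,ỹ)| ≤ (q² + (1+q)²) · max(M_U, M_B) · ‖y‖‖ỹ‖, and b(y,y) ≥ ½ · min(m_U, m_B) · ‖y‖². -/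
/-- Relaxed stable decomposition (Remark 5.2): `Q : Y → Z` bounded linear (not necessarily a
projector), `Qy ∈ U` and `y − Qy ∈ B` for `y ∈ Y`; with bounded and coercive bilinear forms
`b_U` on `U` and `b_B` on `B`, the form `b(y,ỹ) := b_U(Qy,Qỹ) + b_B(y−Qy, ỹ−Qỹ)` satisfies
`|b(y,ỹ)| ≤ (‖Q‖² + (1+‖Q‖)²)·max(M_U,M_B)·‖y‖‖ỹ‖` and
`b(y,y) ≥ ½·min(m_U,m_B)·‖y‖²`. -/
theorem stmt8 {Z : Type*} [NormedAddCommGroup Z] [InnerProductSpace ℝ Z]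
    (Y U B : Submodule ℝ Z) (Q : Y →L[ℝ] Z)
    (hQU : ∀ y : Y, Q y ∈ U) (hQB : ∀ y : Y, (y : Z) - Q y ∈ B)
    (MU MB mU mB : ℝ) (hmU : 0 < mU) (hmB : 0 < mB)
    (bU : ↥U →ₗ[ℝ] ↥U →ₗ[ℝ] ℝ) (bB : ↥B →ₗ[ℝ] ↥B →ₗ[ℝ] ℝ)
    (hbU1 : ∀ u u' : ↥U, |bU u u'| ≤ MU * (‖u‖ * ‖u'‖))
    (hbU2 : ∀ u : ↥U, mU * ‖u‖ ^ 2 ≤ bU u u)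
    (hbB1 : ∀ v v' : ↥B, |bB v v'| ≤ MB * (‖v‖ * ‖v'‖))
    (hbB2 : ∀ v : ↥B, mB * ‖v‖ ^ 2 ≤ bB v v) :
    ∀ y y' : Y,
      |bU ⟨Q y, hQU y⟩ ⟨Q y', hQU y'⟩ +
        bB ⟨(y : Z) - Q y, hQB y⟩ ⟨(y' : Z) - Q y', hQB y'⟩|
        ≤ (‖Q‖ ^ 2 + (1 + ‖Q‖) ^ 2) * max MU MB * (‖y‖ * ‖y'‖) ∧
      (1 / 2 : ℝ) * min mU mB * ‖y‖ ^ 2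
        ≤ bU ⟨Q y, hQU y⟩ ⟨Q y, hQU y⟩ +
          bB ⟨(y : Z) - Q y, hQB y⟩ ⟨(y : Z) - Q y, hQB y⟩ := by
  have eq_zero_of_abs_le_neg_mul : ∀ (M a c : ℝ), M < 0 → |c| ≤ M * (a * a) → a = 0 := by
    intro M a c hM h
    have h0 : 0 ≤ M * (a * a) := (abs_nonneg c).trans h
    by_contra ha
    have hpos : 0 < a * a := mul_self_pos.mpr ha
    exact absurd h0 (not_le.mpr (mul_neg_of_neg_of_pos hM hpos))
  have norm_Q_le : ∀ y : Y, ‖Q y‖ ≤ ‖Q‖ * ‖y‖ := Q.le_opNorm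
  have norm_sub_Q_le : ∀ y : Y, ‖(y : Z) - Q y‖ ≤ (1 + ‖Q‖) * ‖y‖ := by
    intro y
    have h := norm_sub_le (y : Z) (Q y)
    have h' : ‖(y : Z)‖ = ‖y‖ := rfl
    linarith [norm_Q_le y]
  have norm_le : ∀ y : Y, ‖y‖ ≤ ‖Q y‖ + ‖(y : Z) - Q y‖ := by
    intro y
    have h := norm_add_le (Q y) ((y : Z) - Q y)
    rwa [add_sub_cancel] at h
  intro y y'
  constructor
  · have hU := hbU1 ⟨Q y, hQU y⟩ ⟨Q y', hQU y'⟩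
    have hB := hbB1 ⟨(y : Z) - Q y, hQB y⟩ ⟨(y' : Z) - Q y', hQB y'⟩
    simp only [Submodule.coe_norm] at hU hB
    have hsum := (abs_add_le _ _).trans (add_le_add hU hB)
    rcases le_or_gt 0 (max MU MB) with hM | hM
    · have h1 : ‖Q y‖ * ‖Q y'‖ ≤ ‖Q‖ ^ 2 * (‖y‖ * ‖y'‖) :=
        (mul_le_mul (norm_Q_le y) (norm_Q_le y') (norm_nonneg _) (by positivity)).trans_eq
          (by ring)
      have h2 : ‖(y : Z) - Q y‖ * ‖(y' : Z) - Q y'‖ ≤ (1 + ‖Q‖) ^ 2 * (‖y‖ * ‖y'‖) :=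
        (mul_le_mul (norm_sub_Q_le y) (norm_sub_Q_le y') (norm_nonneg _)
          (by positivity)).trans_eq (by ring)
      refine hsum.trans ?_
      calc MU * (‖Q y‖ * ‖Q y'‖) + MB * (‖(y : Z) - Q y‖ * ‖(y' : Z) - Q y'‖)
          ≤ max MU MB * (‖Q y‖ * ‖Q y'‖)
            + max MU MB * (‖(y : Z) - Q y‖ * ‖(y' : Z) - Q y'‖) := by
            gcongr
            · exact le_max_left _ _
            · exact le_max_right _ _
        _ ≤ max MU MB * (‖Q‖ ^ 2 * (‖y‖ * ‖y'‖))
            + max MU MB * ((1 + ‖Q‖) ^ 2 * (‖y‖ * ‖y'‖)) := by gcongr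
        _ = _ := by ring
    · obtain ⟨hMU, hMB⟩ := max_lt_iff.mp hM
      have h1 : ‖Q y‖ = 0 := eq_zero_of_abs_le_neg_mul MU _ _ hMU (hbU1 ⟨Q y, hQU y⟩ ⟨Q y, hQU y⟩)
      have h2 : ‖(y : Z) - Q y‖ = 0 := eq_zero_of_abs_le_neg_mul MB _ _ hMB
        (hbB1 ⟨(y : Z) - Q y, hQB y⟩ ⟨(y : Z) - Q y, hQB y⟩)
      have h3 : ‖y‖ = 0 := le_antisymm (by linarith [norm_le y]) (norm_nonneg y)
      simpa [h1, h2, h3] using hsum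
  · have hU := hbU2 ⟨Q y, hQU y⟩
    have hB := hbB2 ⟨(y : Z) - Q y, hQB y⟩
    simp only [Submodule.coe_norm] at hU hB
    have hm : 0 < min mU mB := lt_min hmU hmB
    have hsq : ‖y‖ ^ 2 ≤ 2 * (‖Q y‖ ^ 2 + ‖(y : Z) - Q y‖ ^ 2) :=
      (pow_le_pow_left₀ (norm_nonneg y) (norm_le y) 2).trans add_sq_le
    calc (1 / 2 : ℝ) * min mU mB * ‖y‖ ^ 2
        ≤ 1 / 2 * min mU mB * (2 * (‖Q y‖ ^ 2 + ‖(y : Z) - Q y‖ ^ 2)) := by gcongr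
      _ = min mU mB * ‖Q y‖ ^ 2 + min mU mB * ‖(y : Z) - Q y‖ ^ 2 := by ring
      _ ≤ mU * ‖Q y‖ ^ 2 + mB * ‖(y : Z) - Q y‖ ^ 2 := by
          gcongr
          · exact min_le_left _ _
          · exact min_le_right _ _
      _ ≤ _ := add_le_add hU hB
end

section
/- Let v_0, …, v_d ∈ ℝ^d be affinely independent, let T := conv{v_0,…,v_d}, let λ_0,…,λ_d be the barycentric coordinate functions of T, and for i ∈ {0,…,d} let T_i := conv({v_i} ∪ {(v_i+v_j)/2 : j ≠ i}) be the corner subsimplex of T at v_i arising from uniform red-refinement. Then for all i, j ∈ {0,…,d}: ∫_T (2^{d+1}·1_{T_i}(x) − 1) · λ_j(x) dx = δ_{ij} · |T|, where |T| is the d-dimensional Lebesgue measure of T and 1_{T_i} is the indicator function of T_i. -/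
open MeasureTheory

/-- Change of variables for a homothety of nonzero ratio, for set integrals. -/
theorem setIntegral_image_homothety {d : ℕ} (c : Fin d → ℝ) {r : ℝ} (hr : r ≠ 0)
    {s : Set (Fin d → ℝ)} (hs : MeasurableSet s) (f : (Fin d → ℝ) → ℝ) :
    ∫ x in AffineMap.homothety c r '' s, f x =
      |r| ^ d * ∫ x in s, f (AffineMap.homothety c r x) := by
  have hderiv : ∀ x ∈ s, HasFDerivWithinAt (AffineMap.homothety c r : (Fin d → ℝ) → Fin d → ℝ)
      (r • ContinuousLinearMap.id ℝ (Fin d → ℝ)) s x := by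
    intro x _
    have h : HasFDerivAt (fun x : Fin d → ℝ => r • (x - c) + c)
        (r • ContinuousLinearMap.id ℝ (Fin d → ℝ)) x :=
      (((hasFDerivAt_id x).sub_const c).const_smul r).add_const c
    exact h.hasFDerivWithinAt
  have hinj : Set.InjOn (AffineMap.homothety c r : (Fin d → ℝ) → Fin d → ℝ) s := by
    intro x _ y _ hxy
    simpa [AffineMap.homothety_apply, hr] using hxy
  have hdet : (r • ContinuousLinearMap.id ℝ (Fin d → ℝ)).det = r ^ d := by
    simp [ContinuousLinearMap.det]
  rw [integral_image_eq_integral_abs_det_fderiv_smul volume hs hderiv hinj, hdet]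
  simp only [smul_eq_mul, abs_pow]
  rw [integral_const_mul]

/-- The corner subsimplex at `v i` is the image of the simplex under the homothety of
ratio `1 / 2` centred at `v i`. -/
theorem convexHull_range_midpoint {ι E : Type*} [AddCommGroup E] [Module ℝ E]
    (v : ι → E) (i : ι) :
    convexHull ℝ (Set.range fun k => midpoint ℝ (v i) (v k)) =
      AffineMap.homothety (v i) (1 / 2 : ℝ) '' convexHull ℝ (Set.range v) := by
  rw [AffineMap.image_convexHull, ← Set.range_comp]
  congr 2
  funext k
  simp [AffineMap.homothety_eq_lineMap, midpoint]

/-- Biorthogonality (Lemma 5.6): with `T_i := conv({v_i} ∪ {(v_i+v_j)/2 : j ≠ i})` the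
corner subsimplices of the red-refinement of the simplex `T = conv{v_0,…,v_d}` and
`λ_j` the barycentric coordinates, one has
`∫_T (2^{d+1}·1_{T_i} − 1)·λ_j dx = δ_{ij}·|T|`. -/
theorem stmt13 (d : ℕ) (v : Fin (d + 1) → (Fin d → ℝ))
    (hv : AffineIndependent ℝ v)
    (lam : Fin (d + 1) → ((Fin d → ℝ) →ᵃ[ℝ] ℝ))
    (hlam : ∀ j k, lam j (v k) = if j = k then 1 else 0)
    (i j : Fin (d + 1)) :
    ∫ x in convexHull ℝ (Set.range v),
      ((2 : ℝ) ^ (d + 1) *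
          Set.indicator (convexHull ℝ (Set.range fun k => midpoint ℝ (v i) (v k)))
            (fun _ => (1 : ℝ)) x - 1) * lam j x =
      if i = j then (volume (convexHull ℝ (Set.range v))).toReal else 0 := by
  have hT : IsCompact (convexHull ℝ (Set.range v)) :=
    (Set.finite_range v).isCompact_convexHull ℝ
  have hTi : IsCompact (convexHull ℝ (Set.range fun k => midpoint ℝ (v i) (v k))) :=
    (Set.finite_range _).isCompact_convexHull ℝ
  have hsub : convexHull ℝ (Set.range fun k => midpoint ℝ (v i) (v k)) ⊆
      convexHull ℝ (Set.range v) := by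
    refine convexHull_min ?_ (convex_convexHull ℝ _)
    rintro _ ⟨k, rfl⟩
    exact (convex_convexHull ℝ _).midpoint_mem
      (subset_convexHull ℝ _ ⟨i, rfl⟩) (subset_convexHull ℝ _ ⟨k, rfl⟩)
  have himage := convexHull_range_midpoint v i
  set T := convexHull ℝ (Set.range v)
  set Ti := convexHull ℝ (Set.range fun k => midpoint ℝ (v i) (v k))
  have hint : IntegrableOn (lam j) T :=
    (lam j).continuous_of_finiteDimensional.continuousOn.integrableOn_compact hT
  have hcorner : ∫ x in Ti, lam j x =
      (1 / 2) ^ (d + 1) * ((∫ x in T, lam j x) + if i = j then volume.real T else 0) := by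
    have hlamh : ∀ x, lam j (AffineMap.homothety (v i) (1 / 2 : ℝ) x) =
        1 / 2 * (lam j x + if i = j then 1 else 0) := by
      intro x
      rw [AffineMap.homothety_eq_lineMap, AffineMap.apply_lineMap, hlam,
        AffineMap.lineMap_apply_module]
      simp only [eq_comm (a := j), smul_eq_mul]
      ring
    rw [himage, setIntegral_image_homothety _ (by norm_num) hT.measurableSet]
    simp only [hlamh]
    rw [integral_const_mul, integral_add hint (integrableOn_const hT.measure_lt_top.ne),
      setIntegral_const, abs_of_pos (by norm_num : (0 : ℝ) < 1 / 2)]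
    simp only [smul_eq_mul, mul_ite, mul_one, mul_zero]
    ring
  have hfun : ∀ x, ((2 : ℝ) ^ (d + 1) * Ti.indicator (fun _ => (1 : ℝ)) x - 1) * lam j x =
      2 ^ (d + 1) * Ti.indicator (lam j) x - lam j x := by
    intro x
    by_cases hx : x ∈ Ti <;> simp [hx]
    ring
  simp only [hfun]
  rw [integral_sub ((hint.indicator hTi.measurableSet).const_mul _) hint, integral_const_mul,
    setIntegral_indicator hTi.measurableSet, Set.inter_eq_right.mpr hsub, hcorner, ← mul_assoc,
    ← mul_pow]
  norm_num [measureReal_def]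
end
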